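/- arXiv:2301.05086 — 7 statements merged into one kernel-verified Lean document; each statement's English description precedes it below -/
import Mathlib

section
/- Let u : [0,∞) → [0,∞) be nondecreasing and sublinear, and let f, g : [0,∞) → (0,∞) be functions such that f(x) + g(x) → ∞ as x → ∞ and such that f(x) ≤ u(f(x) + g(x)) for all sufficiently large x. Then (i) for every s > 1 one has f(x) ≤ u(s·g(x)) for all sufficiently large x, and (ii) there exists a nondecreasing sublinear function u' : [0,∞) → [0,∞) such that f(x) ≤ u'(g(x)) for all sufficiently large x. -/
open Filter

/-- If `u` is nondecreasing and sublinear, `f, g` are positive functions with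
`f + g → ∞` and `f x ≤ u (f x + g x)` for all sufficiently large `x`, then (i) for every `s > 1`
one has `f x ≤ u (s * g x)` eventually, and (ii) there is a nondecreasing sublinear `u'` with
`f x ≤ u' (g x)` eventually. -/
theorem stmt_0 (u f g : ℝ → ℝ)
    (hu_nonneg : ∀ r, 0 ≤ r → 0 ≤ u r)
    (hu_mono : ∀ r s, 0 ≤ r → r ≤ s → u r ≤ u s)
    (hu_sublinear : Tendsto (fun r => u r / r) atTop (nhds 0))
    (hf_pos : ∀ x, 0 ≤ x → 0 < f x)
    (hg_pos : ∀ x, 0 ≤ x → 0 < g x)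
    (hfg : Tendsto (fun x => f x + g x) atTop atTop)
    (hle : ∀ᶠ x in atTop, f x ≤ u (f x + g x)) :
    (∀ s : ℝ, 1 < s → ∀ᶠ x in atTop, f x ≤ u (s * g x)) ∧
    (∃ u' : ℝ → ℝ, (∀ r, 0 ≤ r → 0 ≤ u' r) ∧ (∀ r s, 0 ≤ r → r ≤ s → u' r ≤ u' s) ∧
      Tendsto (fun r => u' r / r) atTop (nhds 0) ∧
      ∀ᶠ x in atTop, f x ≤ u' (g x)) := by
  have key : ∀ s : ℝ, 1 < s → ∀ᶠ x in atTop, f x ≤ u (s * g x) := by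
    intro s hs
    have hs0 : 0 < s := by linarith
    have hε : 0 < (s - 1) / s := div_pos (by linarith) hs0
    filter_upwards [hfg.eventually (hu_sublinear.eventually (gt_mem_nhds hε)), hle,
      eventually_ge_atTop 0] with x hlt hx hx0
    have hf := hf_pos x hx0
    have hg := hg_pos x hx0
    rw [div_lt_div_iff₀ (by linarith) hs0] at hlt
    have hmul : f x * s ≤ u (f x + g x) * s := mul_le_mul_of_nonneg_right hx hs0.le
    exact hx.trans (hu_mono _ _ (by linarith) (by linarith))
  refine ⟨key, fun r => u (2 * r), fun r hr => hu_nonneg _ (by linarith),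
    fun r s hr hrs => hu_mono _ _ (by linarith) (by linarith), ?_, key 2 one_lt_two⟩
  have h2 : Tendsto (fun r : ℝ => 2 * r) atTop atTop := tendsto_id.const_mul_atTop two_pos
  have hlim := (hu_sublinear.comp h2).const_mul 2
  rw [mul_zero] at hlim
  refine hlim.congr fun r => ?_
  simp only [Function.comp_apply]
  rw [← mul_div_assoc, mul_div_mul_left _ _ two_ne_zero]
end

section
/- Let (X, x₀) and (Y, y₀) be pointed metric spaces, let u : [0,∞) → [0,∞) be nondecreasing, and let L ≥ 1 and R₀ > 0. Let p : X → Y be a map such that (1) d(p(x), y₀) ≤ max(d(x,x₀) + u(d(x,x₀)), R₀) for all x ∈ X, and (2) d(p(x), p(x')) ≥ (1/L)·d(x,x') − u(max(d(x,x₀), d(x',x₀))) for all x, x' ∈ X. Then for every r > R₀, writing s := r − u(r), the cardinalities (as extended natural numbers) satisfy #{x ∈ X : d(x,x₀) ≤ s} ≤ #{y ∈ Y : d(y,y₀) ≤ r} · sup_{x ∈ X} #{x' ∈ X : d(x,x') ≤ L·u(s)}. -/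
open Filter Metric

/-- If every nonempty fibre over `t` of a map `s → t` has at most `M` elements, then `s` has at
most `t.encard * M` elements. -/
theorem Set.encard_le_encard_mul_of_mapsTo {α β : Type*} {f : α → β} {s : Set α} {t : Set β}
    {M : ℕ∞} (hf : Set.MapsTo f s t) (hM : ∀ x ∈ s, (s ∩ f ⁻¹' {f x}).encard ≤ M) :
    s.encard ≤ t.encard * M := by
  rcases s.eq_empty_or_nonempty with rfl | ⟨a, ha⟩
  · simp
  have hM_pos : M ≠ 0 := by
    rintro rfl
    have h := hM a ha
    simp only [nonpos_iff_eq_zero, Set.encard_eq_zero] at h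
    exact Set.notMem_empty a (h ▸ ⟨ha, rfl⟩)
  rcases t.finite_or_infinite with ht | ht
  · have key : (s ∩ f ⁻¹' t).encard ≤ t.encard * M := by
      clear hf
      induction t, ht using Set.Finite.induction_on with
      | empty => simp
      | @insert b t hb _ ih =>
        have hb_fibre : (s ∩ f ⁻¹' {b}).encard ≤ M := by
          rcases (s ∩ f ⁻¹' {b}).eq_empty_or_nonempty with h | ⟨x, hx, rfl⟩
          · simp [h]
          · exact hM x hx
        rw [Set.insert_eq, Set.preimage_union, Set.inter_union_distrib_left, ← Set.insert_eq,
          Set.encard_insert_of_notMem hb, add_mul, one_mul, add_comm (t.encard * M)]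
        refine (Set.encard_union_le _ _).trans ?_
        gcongr
    rwa [Set.inter_eq_left.mpr hf.subset_preimage] at key
  · rw [ht.encard_eq, ENat.top_mul hM_pos]
    exact le_top

/-- Ball-counting discrepancy estimate for a map `p : X → Y` between pointed
metric spaces which coarsely does not increase the distance to the base point and coarsely does
not contract distances by more than a factor `L`, with additive error `u`. -/
theorem stmt_1 {X Y : Type*} [MetricSpace X] [MetricSpace Y]
    (x₀ : X) (y₀ : Y) (u : ℝ → ℝ)
    (hu_nonneg : ∀ r, 0 ≤ r → 0 ≤ u r)
    (hu_mono : ∀ r s, 0 ≤ r → r ≤ s → u r ≤ u s)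
    (L R₀ : ℝ) (hL : 1 ≤ L) (hR₀ : 0 < R₀)
    (p : X → Y)
    (h1 : ∀ x : X, dist (p x) y₀ ≤ max (dist x x₀ + u (dist x x₀)) R₀)
    (h2 : ∀ x x' : X,
      (1 / L) * dist x x' - u (max (dist x x₀) (dist x' x₀)) ≤ dist (p x) (p x')) :
    ∀ r : ℝ, R₀ < r →
      {x : X | dist x x₀ ≤ r - u r}.encard ≤
        {y : Y | dist y y₀ ≤ r}.encard *
          ⨆ x : X, {x' : X | dist x x' ≤ L * u (r - u r)}.encard := by
  intro r hr
  have hur : 0 ≤ u r := hu_nonneg r (hR₀.trans hr).le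
  refine Set.encard_le_encard_mul_of_mapsTo (f := p) ?_ ?_
  · intro x (hx : dist x x₀ ≤ r - u r)
    have hu : u (dist x x₀) ≤ u r := hu_mono _ _ dist_nonneg (by linarith)
    exact (h1 x).trans (max_le (by linarith) hr.le)
  · intro x (hx : dist x x₀ ≤ r - u r)
    refine le_trans (Set.encard_le_encard ?_)
      (le_iSup (fun x : X ↦ {x' : X | dist x x' ≤ L * u (r - u r)}.encard) x)
    rintro x' ⟨hx' : dist x' x₀ ≤ r - u r, hpx : p x' = p x⟩
    have hu : u (max (dist x x₀) (dist x' x₀)) ≤ u (r - u r) :=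
      hu_mono _ _ (le_max_of_le_left dist_nonneg) (max_le hx hx')
    have h := h2 x x'
    rw [hpx, dist_self, one_div_mul_eq_div] at h
    have hdiv : dist x x' / L ≤ u (r - u r) := by linarith
    rwa [div_le_iff₀' (by linarith)] at hdiv
end

section
/- Let X be a metric space, let G be a group acting on X by isometries, let Γ and Λ be subgroups of G, and let x₀ ∈ X be such that the orbits Γ·x₀ and Λ·x₀ are locally finite subsets of X. Let u : [0,∞) → [0,∞) be nondecreasing with limsup_{r→∞} u(r)/r ≤ ε for some ε < 1/2, and assume every point γ·x₀ of the orbit Γ·x₀ satisfies d(γ·x₀, Λ·x₀) ≤ u(d(γ·x₀, x₀)). Then δ(Λ·x₀) ≥ (1 − 4ε)·δ(Γ·x₀), as an inequality of extended reals. -/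
open Filter Metric

/-- The critical exponent of a subset `W` of a pointed metric space `(X, x₀)`:
`δ(W) = limsup_{r → ∞} log #(W ∩ closedBall x₀ r) / r`, computed in the extended reals. -/
noncomputable def critExp {X : Type*} [MetricSpace X] (x₀ : X) (W : Set X) : EReal :=
  Filter.limsup
    (fun r : ℝ => ((Real.log ((W ∩ Metric.closedBall x₀ r).ncard : ℝ) / r : ℝ) : EReal))
    Filter.atTop

/-- The number of points of the orbit of `x₀` under `H` in the closed ball of radius `r`. -/
noncomputable def orbitCount {G X : Type*} [Group G] [MetricSpace X] [MulAction G X]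
    (H : Subgroup G) (x₀ : X) (r : ℝ) : ℕ :=
  (((fun g : G => g • x₀) '' (H : Set G)) ∩ Metric.closedBall x₀ r).ncard

section OrbitCount

variable {G X : Type*} [Group G] [MetricSpace X] [MulAction G X] {H Γ Λ : Subgroup G} {x₀ : X}

lemma orbitCount_mono
    (hH : ∀ (x : X) (r : ℝ),
      (((fun g : G => g • x₀) '' (H : Set G)) ∩ Metric.closedBall x r).Finite) :
    Monotone (orbitCount H x₀) := fun _ s hrs =>
  Set.ncard_le_ncard
    (Set.inter_subset_inter_right _ (Metric.closedBall_subset_closedBall hrs)) (hH x₀ s)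

lemma one_le_orbitCount
    (hH : ∀ (x : X) (r : ℝ),
      (((fun g : G => g • x₀) '' (H : Set G)) ∩ Metric.closedBall x r).Finite)
    {r : ℝ} (hr : 0 ≤ r) : 1 ≤ orbitCount H x₀ r := by
  rw [orbitCount, Nat.one_le_iff_ne_zero, ← Nat.pos_iff_ne_zero, Set.ncard_pos (hH x₀ r)]
  exact ⟨x₀, ⟨1, H.one_mem, one_smul _ _⟩, Metric.mem_closedBall_self hr⟩

lemma critExp_orbit_nonneg :
    0 ≤ critExp x₀ ((fun g : G => g • x₀) '' (H : Set G)) := by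
  refine le_limsup_of_frequently_le (Eventually.frequently ?_)
  filter_upwards [eventually_ge_atTop 0] with r hr
  exact_mod_cast div_nonneg (Real.log_natCast_nonneg _) hr

/-- If the points of the `Γ`-orbit in the ball of radius `r` are `v`-close to the `Λ`-orbit, they
map to the `Λ`-orbit with fibres of diameter at most `2 * v`. -/
lemma orbitCount_le_mul
    (hiso : ∀ (g : G) (x y : X), dist (g • x) (g • y) = dist x y)
    (hΓ : ∀ (x : X) (r : ℝ),
      (((fun g : G => g • x₀) '' (Γ : Set G)) ∩ Metric.closedBall x r).Finite)
    (hΛ : ∀ (x : X) (r : ℝ),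
      (((fun g : G => g • x₀) '' (Λ : Set G)) ∩ Metric.closedBall x r).Finite)
    {r v : ℝ}
    (hclose : ∀ y ∈ ((fun g : G => g • x₀) '' (Γ : Set G)) ∩ Metric.closedBall x₀ r,
      ∃ z ∈ (fun g : G => g • x₀) '' (Λ : Set G), dist y z ≤ v) :
    orbitCount Γ x₀ r ≤ orbitCount Γ x₀ (2 * v) * orbitCount Λ x₀ (r + v) := by
  classical
  choose! φ hφ hφd using hclose
  set A := (hΓ x₀ r).toFinset with hA
  have hmem : ∀ y, y ∈ A ↔
      y ∈ ((fun g : G => g • x₀) '' (Γ : Set G)) ∩ Metric.closedBall x₀ r := fun y => by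
    simp [hA]
  have hcard : orbitCount Γ x₀ r = A.card := Set.ncard_eq_toFinset_card _ (hΓ x₀ r)
  have hfib : ∀ b ∈ A.image φ, (A.filter (fun y => φ y = b)).card ≤ orbitCount Γ x₀ (2 * v) := by
    intro b hb
    obtain ⟨y₀, hy₀, rfl⟩ := Finset.mem_image.1 hb
    rw [hmem] at hy₀
    obtain ⟨γ₀, hγ₀, hγy⟩ := hy₀.1
    rw [orbitCount, ← Set.ncard_coe_finset]
    refine Set.ncard_le_ncard_of_injOn (fun y => γ₀⁻¹ • y) ?_
      ((MulAction.injective γ₀⁻¹).injOn) (hΓ x₀ _)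
    intro y hy
    rw [Finset.mem_coe, Finset.mem_filter, hmem] at hy
    obtain ⟨hy, hyφ⟩ := hy
    obtain ⟨γ, hγ, rfl⟩ := hy.1
    refine ⟨⟨γ₀⁻¹ * γ, Γ.mul_mem (Γ.inv_mem hγ₀) hγ, mul_smul _ _ _⟩, ?_⟩
    rw [Metric.mem_closedBall, ← hiso γ₀, smul_inv_smul]
    have h1 := hφd _ hy
    have h2 := hφd _ hy₀
    rw [hyφ] at h1
    simp only at hγy
    rw [hγy]
    have h3 := dist_triangle_right ((fun g : G => g • x₀) γ) y₀ (φ y₀)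
    linarith
  have himg : (A.image φ).card ≤ orbitCount Λ x₀ (r + v) := by
    rw [orbitCount, ← Set.ncard_coe_finset]
    refine Set.ncard_le_ncard ?_ (hΛ x₀ _)
    intro z hz
    obtain ⟨y, hy, rfl⟩ := Finset.mem_image.1 (Finset.mem_coe.1 hz)
    rw [hmem] at hy
    refine ⟨hφ y hy, ?_⟩
    have h1 := hφd y hy
    have h2 := Metric.mem_closedBall.1 hy.2
    have h3 := dist_triangle_left (φ y) x₀ y
    rw [Metric.mem_closedBall]
    linarith
  rw [hcard]
  exact (Finset.card_le_mul_card_image A _ hfib).trans (Nat.mul_le_mul_left _ himg)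

end OrbitCount

/-- A monotone function with `f r ≤ c * r + f (q * r)` for large `r`, `q < 1`, grows at most
linearly, with slope `c / (1 - q)`. -/
lemma le_linear_of_le_add_contraction {f : ℝ → ℝ} (hf : Monotone f) {c q R : ℝ}
    (hq0 : 0 < q) (hq1 : q < 1) (hc : 0 ≤ c) (hR : 0 < R)
    (h : ∀ r, R ≤ r → f r ≤ c * r + f (q * r)) {r : ℝ} (hr : 0 ≤ r) :
    f r ≤ c / (1 - q) * r + f R := by
  have hC : 0 ≤ c / (1 - q) := div_nonneg hc (by linarith)
  have hCq : c + c / (1 - q) * q = c / (1 - q) := by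
    have : (1 - q) ≠ 0 := by linarith
    field_simp
    ring
  have key : ∀ n : ℕ, ∀ s, 0 ≤ s → q ^ n * s ≤ R → f s ≤ c / (1 - q) * s + f R := by
    intro n
    induction n with
    | zero =>
      intro s hs hsR
      have := hf (show s ≤ R by simpa using hsR)
      have := mul_nonneg hC hs
      linarith
    | succ n ih =>
      intro s hs hsR
      rcases le_total s R with hle | hle
      · have := hf hle
        have := mul_nonneg hC hs
        linarith
      · have h1 := h s hle
        have h2 := ih (q * s) (by positivity) (by rw [← mul_assoc, ← pow_succ]; exact hsR)
        calc f s ≤ (c + c / (1 - q) * q) * s + f R := by linarith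
          _ = _ := by rw [hCq]
  have ht : Tendsto (fun n : ℕ => q ^ n * r) atTop (nhds 0) := by
    simpa using (tendsto_pow_atTop_nhds_zero_of_lt_one hq0.le hq1).mul_const r
  obtain ⟨n, hn⟩ := (ht.eventually (eventually_le_nhds hR)).exists
  exact key n r hr hn

/-- A function with an eventual linear upper bound has exponential growth rate at most the slope. -/
lemma limsup_div_le_of_le_linear {f : ℝ → ℝ} {C K : ℝ} (h : ∀ r, 0 ≤ r → f r ≤ C * r + K) :
    limsup (fun r : ℝ => ((f r / r : ℝ) : EReal)) atTop ≤ (C : EReal) := by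
  have ht : Tendsto (fun r : ℝ => ((C + K / r : ℝ) : EReal)) atTop (nhds (C : EReal)) := by
    refine (continuous_coe_real_ereal.tendsto C).comp ?_
    simpa using (tendsto_const_nhds (x := C)).add (tendsto_const_nhds.div_atTop tendsto_id)
  rw [← ht.limsup_eq]
  refine limsup_le_limsup ?_
  filter_upwards [eventually_gt_atTop 0] with r hr
  rw [EReal.coe_le_coe_iff, div_le_iff₀ hr, add_mul, div_mul_cancel₀ _ hr.ne']
  exact h r hr.le

/-- For a group `G` acting by isometries on `X` with subgroups `Γ, Λ` having
locally finite orbits of `x₀`, if the `Γ`-orbit lies in the `u`-neighbourhood of the `Λ`-orbit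
for a nondecreasing `u` with `limsup u r / r ≤ ε < 1/2`, then
`δ(Λ·x₀) ≥ (1 - 4ε)·δ(Γ·x₀)`. -/
theorem stmt_4 {G X : Type*} [Group G] [MetricSpace X] [MulAction G X]
    (hiso : ∀ (g : G) (x y : X), dist (g • x) (g • y) = dist x y)
    (Γ Λ : Subgroup G) (x₀ : X)
    (hΓ : ∀ (x : X) (r : ℝ),
      (((fun g : G => g • x₀) '' (Γ : Set G)) ∩ Metric.closedBall x r).Finite)
    (hΛ : ∀ (x : X) (r : ℝ),
      (((fun g : G => g • x₀) '' (Λ : Set G)) ∩ Metric.closedBall x r).Finite)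
    (u : ℝ → ℝ) (hu_nonneg : ∀ r, 0 ≤ r → 0 ≤ u r)
    (hu_mono : ∀ r s, 0 ≤ r → r ≤ s → u r ≤ u s)
    (ε : ℝ) (hε : ε < 1 / 2)
    (hu_lim : Filter.limsup (fun r : ℝ => ((u r / r : ℝ) : EReal)) Filter.atTop ≤ (ε : EReal))
    (hcover : ∀ γ : G, γ ∈ Γ →
      Metric.infDist (γ • x₀) ((fun g : G => g • x₀) '' (Λ : Set G)) ≤ u (dist (γ • x₀) x₀)) :
    ((1 - 4 * ε : ℝ) : EReal) * critExp x₀ ((fun g : G => g • x₀) '' (Γ : Set G)) ≤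
      critExp x₀ ((fun g : G => g • x₀) '' (Λ : Set G)) := by
  have hε0 : 0 ≤ ε := by
    have h0 : (0 : EReal) ≤ ε := by
      refine le_trans (le_limsup_of_frequently_le (Eventually.frequently ?_)) hu_lim
      filter_upwards [eventually_ge_atTop 0] with r hr
      exact_mod_cast div_nonneg (hu_nonneg r hr) hr
    exact_mod_cast h0
  rcases le_or_gt (1 - 4 * ε) 0 with ha | ha
  · refine le_trans ?_ critExp_orbit_nonneg
    exact EReal.mul_nonpos_iff.2 (Or.inr ⟨by exact_mod_cast ha, critExp_orbit_nonneg⟩)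
  refine EReal.le_of_forall_lt_iff_le.1 fun D hD => ?_
  obtain ⟨D', hD', hD'D⟩ := EReal.lt_iff_exists_real_btwn.1 hD
  have hD'D : D' < D := by exact_mod_cast hD'D
  have hD'0 : 0 < D' := by
    exact_mod_cast critExp_orbit_nonneg.trans_lt hD'
  obtain ⟨e, ⟨he2, hea⟩, hεe⟩ : ∃ e, (e < 1 / 2 ∧
      (1 - 4 * ε) * ((1 + e) * D') < (1 - 2 * e) * D) ∧ ε < e := by
    have hlt : (1 - 4 * ε) * ((1 + ε) * D') < (1 - 2 * ε) * D := by
      nlinarith [mul_nonneg hε0 hD'0.le, mul_nonneg hε0 (mul_nonneg hε0 hD'0.le),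
        mul_pos (show 0 < 1 - 2 * ε by linarith) (sub_pos.2 hD'D)]
    have h1 : ∀ᶠ e in nhds ε, e < 1 / 2 := eventually_lt_nhds hε
    have h2 : ∀ᶠ e in nhds ε, (1 - 4 * ε) * ((1 + e) * D') < (1 - 2 * e) * D :=
      ContinuousAt.eventually_lt (by fun_prop) (by fun_prop) hlt
    exact (((h1.and h2).filter_mono nhdsWithin_le_nhds).and
      (self_mem_nhdsWithin (s := Set.Ioi ε))).exists
  have he0 : 0 < e := hε0.trans_lt hεe
  obtain ⟨e', hεe', he'e⟩ := exists_between hεe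
  have hu_ev : ∀ᶠ r in atTop, u r + 1 ≤ e * r := by
    have h1 := eventually_lt_of_limsup_lt
      (hu_lim.trans_lt (show (ε : EReal) < (e' : EReal) by exact_mod_cast hεe'))
    filter_upwards [h1, eventually_gt_atTop 0, eventually_ge_atTop (1 / (e - e'))]
      with r hr hr0 hr1
    have hr : u r / r < e' := by exact_mod_cast hr
    rw [div_lt_iff₀ hr0] at hr
    rw [div_le_iff₀ (by linarith)] at hr1
    linarith
  have hΛ_ev : ∀ᶠ r in atTop, Real.log (orbitCount Λ x₀ r) ≤ D' * r := by
    filter_upwards [eventually_lt_of_limsup_lt hD', eventually_gt_atTop 0] with r hr hr0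
    have hr : Real.log (orbitCount Λ x₀ r) / r < D' := by exact_mod_cast hr
    rw [div_lt_iff₀ hr0] at hr
    exact hr.le
  have hscale : Tendsto (fun r : ℝ => r + e * r) atTop atTop :=
    tendsto_atTop_mono' atTop (by
      filter_upwards [eventually_ge_atTop 0] with r hr
      exact le_add_of_nonneg_right (by positivity)) tendsto_id
  obtain ⟨R, hR⟩ := eventually_atTop.1
    ((hu_ev.and (hscale.eventually hΛ_ev)).and (eventually_gt_atTop (0 : ℝ)))
  have hstep : ∀ r, R ≤ r → Real.log (orbitCount Γ x₀ r) ≤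
      (1 + e) * D' * r + Real.log (orbitCount Γ x₀ (2 * e * r)) := by
    intro r hr
    obtain ⟨⟨hur, hlog⟩, hr0⟩ := hR r hr
    have hle := orbitCount_le_mul hiso hΓ hΛ (r := r) (v := e * r) (by
      rintro _ ⟨⟨γ, hγ, rfl⟩, hy⟩
      have hmono := hu_mono _ _ dist_nonneg (Metric.mem_closedBall.1 hy)
      obtain ⟨z, hz, hdz⟩ := (Metric.infDist_lt_iff
        (s := (fun g : G => g • x₀) '' (Λ : Set G)) ⟨x₀, 1, Λ.one_mem, one_smul _ _⟩).1
        ((hcover γ hγ).trans_lt (lt_add_one _))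
      exact ⟨z, hz, by simp only at hmono ⊢; linarith⟩)
    have h1 : (1 : ℝ) ≤ orbitCount Γ x₀ r := by exact_mod_cast one_le_orbitCount hΓ hr0.le
    have h2 : (1 : ℝ) ≤ orbitCount Γ x₀ (2 * (e * r)) := by
      exact_mod_cast one_le_orbitCount hΓ (by positivity)
    have h3 : (1 : ℝ) ≤ orbitCount Λ x₀ (r + e * r) := by
      exact_mod_cast one_le_orbitCount hΛ (by positivity)
    have h4 := Real.log_le_log (by linarith) (show (orbitCount Γ x₀ r : ℝ) ≤
      orbitCount Γ x₀ (2 * (e * r)) * orbitCount Λ x₀ (r + e * r) by exact_mod_cast hle)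
    rw [Real.log_mul (by linarith) (by linarith)] at h4
    rw [mul_assoc 2 e r]
    linarith
  have hmono : Monotone fun r => Real.log (orbitCount Γ x₀ r) := by
    intro r s hrs
    have hle := orbitCount_mono hΓ hrs
    rcases Nat.eq_zero_or_pos (orbitCount Γ x₀ r) with h0 | h0
    · simp only [h0, Nat.cast_zero, Real.log_zero]
      exact Real.log_natCast_nonneg _
    · exact Real.log_le_log (by exact_mod_cast h0) (by exact_mod_cast hle)
  have hΓ_le : critExp x₀ ((fun g : G => g • x₀) '' (Γ : Set G)) ≤
      (((1 + e) * D' / (1 - 2 * e) : ℝ) : EReal) :=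
    limsup_div_le_of_le_linear fun r hr =>
      le_linear_of_le_add_contraction hmono (by positivity) (by linarith) (by positivity)
        (hR R le_rfl).2 hstep hr
  refine (mul_le_mul_of_nonneg_left hΓ_le (by exact_mod_cast ha.le)).trans ?_
  rw [← EReal.coe_mul, EReal.coe_le_coe_iff, ← mul_div_assoc, div_le_iff₀ (by linarith)]
  linarith
end

section
/- Let X be a metric space with base point x₀, let B ⊆ X be a subset with x₀ ∈ B, let A ⊆ X, and let u : [0,∞) → [0,∞) be nondecreasing with limsup_{r→∞} u(r)/r ≤ ε for some ε < 1. Assume every a ∈ A satisfies d(a, B) ≤ u(d(a, x₀)). Fix x ∈ X. Then there exists S ∈ (0,1) such that for every s ∈ (0,S) there exists R > 0 with the following property: for every y ∈ X and every r > R such that d(x,y) = r and the open ball of radius r about y is disjoint from B, the open ball of radius s·r about y is disjoint from A. -/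
open Filter Metric

/-- If `A` lies in the `u`-neighbourhood of `B` (with `x₀ ∈ B`), where `u` is
nondecreasing with `limsup u r / r ≤ ε < 1`, then for every `x` there is `S ∈ (0,1)` such that
for every `s ∈ (0,S)` there is `R > 0` with: every `B`-free open ball of radius `r > R` tangent
to `x` yields a concentric `A`-free open ball of radius `s·r`. -/
theorem stmt_5 {X : Type*} [MetricSpace X] (x₀ : X) (A B : Set X) (hx₀ : x₀ ∈ B)
    (u : ℝ → ℝ) (hu_nonneg : ∀ r, 0 ≤ r → 0 ≤ u r)
    (hu_mono : ∀ r s, 0 ≤ r → r ≤ s → u r ≤ u s)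
    (ε : ℝ) (hε : ε < 1)
    (hu_lim : Filter.limsup (fun r : ℝ => ((u r / r : ℝ) : EReal)) Filter.atTop ≤ (ε : EReal))
    (hA : ∀ a ∈ A, Metric.infDist a B ≤ u (dist a x₀))
    (x : X) :
    ∃ S : ℝ, S ∈ Set.Ioo (0 : ℝ) 1 ∧ ∀ s ∈ Set.Ioo (0 : ℝ) S, ∃ R : ℝ, 0 < R ∧
      ∀ (y : X) (r : ℝ), R < r → dist x y = r → Metric.ball y r ∩ B = ∅ →
        Metric.ball y (s * r) ∩ A = ∅ := by
  obtain ⟨δ, hδ, hδ1⟩ := exists_between (max_lt hε one_pos)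
  obtain ⟨hεδ, hδ0⟩ := max_lt_iff.1 hδ
  obtain ⟨R₀, hR₀⟩ := Filter.eventually_atTop.1
    (Filter.eventually_lt_of_limsup_lt (hu_lim.trans_lt (EReal.coe_lt_coe_iff.2 hεδ)))
  refine ⟨(1 - δ) / (1 + δ), ⟨div_pos (by linarith) (by linarith), ?_⟩, ?_⟩
  · rw [div_lt_one (by linarith)]
    linarith
  rintro s ⟨hs0, hsS⟩
  rw [lt_div_iff₀ (by linarith)] at hsS
  have hc : 0 < 1 - s - δ * (1 + s) := by linarith
  refine ⟨max 1 (max R₀ (δ * dist x x₀ / (1 - s - δ * (1 + s)))),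
    lt_max_of_lt_left one_pos, ?_⟩
  intro y r hr hxy hB
  simp only [max_lt_iff] at hr
  obtain ⟨hr1, hrR₀, hrD⟩ := hr
  rw [div_lt_iff₀ hc] at hrD
  rw [Set.eq_empty_iff_forall_notMem]
  rintro a ⟨hay, haA⟩
  rw [mem_ball] at hay
  have hlower : r - s * r ≤ infDist a B := by
    refine (le_infDist ⟨x₀, hx₀⟩).2 fun {b} hb => ?_
    have hby : r ≤ dist b y := by
      by_contra! h
      exact Set.eq_empty_iff_forall_notMem.1 hB b ⟨h, hb⟩
    linarith [dist_triangle_left b y a]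
  have hdist : dist a x₀ ≤ (1 + s) * r + dist x x₀ := by
    linarith [dist_triangle4 a y x x₀, dist_comm x y]
  have hsr : 0 < s * r := mul_pos hs0 (by linarith)
  have hD : 0 ≤ dist x x₀ := dist_nonneg
  have hρ : 0 < (1 + s) * r + dist x x₀ := by linarith
  have hu : u ((1 + s) * r + dist x x₀) < δ * ((1 + s) * r + dist x x₀) :=
    (div_lt_iff₀ hρ).1 (EReal.coe_lt_coe_iff.1 (hR₀ _ (by linarith)))
  linarith [hA a haA, hu_mono _ _ dist_nonneg hdist]
end

section
/- Let X be a metric space with base point x₀, let B ⊆ X be a subset with x₀ ∈ B, let A ⊆ X, and let u : [0,∞) → [0,∞) be nondecreasing and sublinear. Assume every a ∈ A satisfies d(a, B) ≤ u(d(a, x₀)). Then for every x ∈ X and every s ∈ (0,1) there exists R > 0 with the following property: for every y ∈ X and every r > R such that d(x,y) = r and the open ball of radius r about y is disjoint from B, the open ball of radius s·r about y is disjoint from A. -/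
open Filter Metric

/-- If `A` lies in the `u`-neighbourhood of `B` (with `x₀ ∈ B`), where `u` is
nondecreasing and sublinear, then for every `x` and every `s ∈ (0,1)` there is `R > 0` with:
every `B`-free open ball of radius `r > R` tangent to `x` yields a concentric `A`-free open
ball of radius `s·r`. -/
theorem stmt_6 {X : Type*} [MetricSpace X] (x₀ : X) (A B : Set X) (hx₀ : x₀ ∈ B)
    (u : ℝ → ℝ) (hu_nonneg : ∀ r, 0 ≤ r → 0 ≤ u r)
    (hu_mono : ∀ r s, 0 ≤ r → r ≤ s → u r ≤ u s)
    (hu_sublinear : Filter.Tendsto (fun r => u r / r) Filter.atTop (nhds 0))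
    (hA : ∀ a ∈ A, Metric.infDist a B ≤ u (dist a x₀)) :
    ∀ (x : X), ∀ s ∈ Set.Ioo (0 : ℝ) 1, ∃ R : ℝ, 0 < R ∧
      ∀ (y : X) (r : ℝ), R < r → dist x y = r → Metric.ball y r ∩ B = ∅ →
        Metric.ball y (s * r) ∩ A = ∅ := by
  rintro x s ⟨hs₀, hs₁⟩
  obtain ⟨N, hN⟩ := eventually_atTop.1
    (hu_sublinear.eventually (gt_mem_nhds (show (0 : ℝ) < (1 - s) / 3 by linarith)))
  refine ⟨max 1 (max N (dist x x₀)), lt_max_of_lt_left one_pos, fun y r hr hxy hB => ?_⟩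
  obtain ⟨hr₁, hr₂⟩ := max_lt_iff.1 hr
  obtain ⟨hrN, hrx⟩ := max_lt_iff.1 hr₂
  refine Set.eq_empty_iff_forall_notMem.2 ?_
  rintro a ⟨hay, haA⟩
  rw [mem_ball] at hay
  have hlower : (1 - s) * r ≤ infDist a B := by
    refine (le_infDist ⟨x₀, hx₀⟩).2 fun b hb => ?_
    have hby : r ≤ dist b y := by
      by_contra! h
      exact Set.eq_empty_iff_forall_notMem.1 hB b ⟨mem_ball.2 h, hb⟩
    have := dist_triangle_left b y a
    linarith
  have hax₀ : dist a x₀ ≤ 3 * r := by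
    have h₁ := dist_triangle a y x₀
    have h₂ := dist_triangle_left y x₀ x
    nlinarith
  have hu : u (3 * r) < (1 - s) / 3 * (3 * r) :=
    (div_lt_iff₀ (by linarith)).1 (hN (3 * r) (by linarith))
  have := hA a haA
  have := hu_mono _ _ dist_nonneg hax₀
  linarith
end

section
/- Let X be a metric space, let Λ be a group acting on X by isometries, let x₀ ∈ X, and suppose the orbit O := Λ·x₀ is a locally finite subset of X. Let A ⊆ X and C > 0 be such that every point of X lies within distance C of A. Let u : [0,∞) → [0,∞) be nondecreasing with limsup_{r→∞} u(r)/r < 1, and assume every a ∈ A satisfies d(a, O) ≤ u(d(a, x₀)). Then there exists D > 0 such that d(a, O) ≤ D for every a ∈ A. -/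
open Filter Metric

/-- If `infDist x A < C` for all `x` and the distance from `a ∈ A` to an orbit of an isometric action
is controlled by `u`, then that distance `r` satisfies `r ≤ C + 1 + u (r + 1 + C)`. -/
theorem infDist_orbit_le_of_net {Λ X : Type*} [Group Λ] [MetricSpace X] [MulAction Λ X]
    (hiso : ∀ (l : Λ) (x y : X), dist (l • x) (l • y) = dist x y) {x₀ : X} {A : Set X} {C : ℝ}
    (hnet : ∀ x : X, Metric.infDist x A < C) {u : ℝ → ℝ}
    (hu_mono : ∀ r s, 0 ≤ r → r ≤ s → u r ≤ u s)
    (hA : ∀ a ∈ A, Metric.infDist a (MulAction.orbit Λ x₀) ≤ u (dist a x₀)) {a : X} (ha : a ∈ A) :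
    Metric.infDist a (MulAction.orbit Λ x₀) ≤
      C + 1 + u (Metric.infDist a (MulAction.orbit Λ x₀) + 1 + C) := by
  have hne : (MulAction.orbit Λ x₀).Nonempty := MulAction.nonempty_orbit x₀
  obtain ⟨_, ⟨l, rfl⟩, hl⟩ := (infDist_lt_iff hne).1
    (lt_add_one (infDist a (MulAction.orbit Λ x₀)))
  obtain ⟨b, hb, hxb⟩ := (infDist_lt_iff ⟨a, ha⟩).1 (hnet (l⁻¹ • a))
  obtain ⟨_, ⟨m, rfl⟩, hm⟩ := (infDist_lt_iff hne).1
    (lt_add_one (infDist b (MulAction.orbit Λ x₀)))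
  have hlx : dist (l⁻¹ • a) x₀ = dist a (l • x₀) := by
    rw [← hiso l, smul_inv_smul]
  have hlm : dist (l⁻¹ • a) (m • x₀) = dist a ((l * m) • x₀) := by
    rw [← hiso l, smul_inv_smul, mul_smul]
  have hle : infDist a (MulAction.orbit Λ x₀) ≤ dist a ((l * m) • x₀) :=
    infDist_le_dist_of_mem ⟨l * m, rfl⟩
  have hbx : dist b x₀ ≤ infDist a (MulAction.orbit Λ x₀) + 1 + C := by
    have := dist_triangle_left b x₀ (l⁻¹ • a)
    dsimp only at hl
    linarith
  have hu := hu_mono _ _ dist_nonneg hbx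
  have hbA := hA b hb
  have := dist_triangle (l⁻¹ • a) b (m • x₀)
  dsimp only at hm
  linarith

/-- Let a group `Λ` act on `X` by isometries with locally finite orbit
`O = Λ·x₀`, let `A` be a `C`-net of `X`, and let `u` be nondecreasing with
`limsup u r / r < 1`. If every `a ∈ A` satisfies `d(a, O) ≤ u (d(a, x₀))`, then `A` lies in a
bounded neighbourhood of `O`. -/
theorem stmt_7 {Λ X : Type*} [Group Λ] [MetricSpace X] [MulAction Λ X]
    (hiso : ∀ (l : Λ) (x y : X), dist (l • x) (l • y) = dist x y)
    (x₀ : X)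
    (hO : ∀ (x : X) (r : ℝ), (MulAction.orbit Λ x₀ ∩ Metric.closedBall x r).Finite)
    (A : Set X) (C : ℝ) (hC : 0 < C)
    (hnet : ∀ x : X, Metric.infDist x A ≤ C)
    (u : ℝ → ℝ) (hu_nonneg : ∀ r, 0 ≤ r → 0 ≤ u r)
    (hu_mono : ∀ r s, 0 ≤ r → r ≤ s → u r ≤ u s)
    (hu_lim : Filter.limsup (fun r : ℝ => ((u r / r : ℝ) : EReal)) Filter.atTop < 1)
    (hA : ∀ a ∈ A, Metric.infDist a (MulAction.orbit Λ x₀) ≤ u (dist a x₀)) :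
    ∃ D : ℝ, 0 < D ∧ ∀ a ∈ A, Metric.infDist a (MulAction.orbit Λ x₀) ≤ D := by
  obtain ⟨ε, hε, hε1⟩ := EReal.lt_iff_exists_real_btwn.1 (max_lt hu_lim zero_lt_one)
  obtain ⟨hlim, hε0⟩ := max_lt_iff.1 hε
  replace hε0 : 0 < ε := by exact_mod_cast hε0
  replace hε1 : ε < 1 := by exact_mod_cast hε1
  obtain ⟨R, hR⟩ := eventually_atTop.1
    ((eventually_lt_of_limsup_lt hlim).and (eventually_gt_atTop (0 : ℝ)))
  have hR0 : 0 < R := (hR R le_rfl).2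
  have huR := hu_nonneg R hR0.le
  have hε1' : 0 < 1 - ε := sub_pos.2 hε1
  refine ⟨C + 2 + u R + (C + 2 + ε * (C + 2)) / (1 - ε), by positivity, fun a ha => ?_⟩
  have key := infDist_orbit_le_of_net hiso (C := C + 1)
    (fun x => (hnet x).trans_lt (lt_add_one C)) hu_mono hA ha
  have hr : 0 ≤ infDist a (MulAction.orbit Λ x₀) := infDist_nonneg
  generalize infDist a (MulAction.orbit Λ x₀) = r at key hr ⊢
  rcases le_total (r + 1 + (C + 1)) R with h | h
  · have hu := hu_mono _ _ (by positivity) h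
    have : 0 ≤ (C + 2 + ε * (C + 2)) / (1 - ε) := by positivity
    linarith
  · obtain ⟨hlt, hpos⟩ := hR _ h
    have hu := (div_lt_iff₀ hpos).1 (EReal.coe_lt_coe_iff.1 hlt)
    have : r ≤ (C + 2 + ε * (C + 2)) / (1 - ε) := by
      rw [le_div_iff₀ hε1']
      linarith
    linarith
end

section
/- Let Λ be a group equipped with a left-invariant metric, with |λ| := d(λ, 1), and let (X, x₀) be a pointed metric space, with |x| := d(x, x₀). Let L ≥ 1 and let u : [0,∞) → [0,∞) be nondecreasing, subadditive and sublinear. Suppose f : Λ → X and g : X → Λ satisfy: g(x₀) = 1; d(f(a), f(b)) ≤ L·d(a,b) + u(max(|a|,|b|)) for all a, b ∈ Λ; d(g(x), g(y)) ≤ L·d(x,y) + u(max(|x|,|y|)) for all x, y ∈ X; and d(g(f(a)), a) ≤ u(|a|) for all a ∈ Λ. Then for all λ₁, λ₂ ∈ Λ there exists a nondecreasing sublinear function v : [0,∞) → [0,∞) such that for all x ∈ X: d( f(λ₁·g(f(λ₂·g(x)))), f((λ₁λ₂)·g(x)) ) ≤ v(|x|). -/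
open Filter Metric

/-- Precomposing a nondecreasing sublinear function with a function of at most linear growth
gives a sublinear function. -/
theorem tendsto_comp_div_atTop_zero {u h : ℝ → ℝ} (hu_nonneg : ∀ r, 0 ≤ r → 0 ≤ u r)
    (hu_mono : ∀ r s, 0 ≤ r → r ≤ s → u r ≤ u s)
    (hu : Tendsto (fun r => u r / r) atTop (nhds 0)) {C : ℝ} (hC : 0 < C)
    (hh : ∀ᶠ r in atTop, 0 ≤ h r ∧ h r ≤ C * r) :
    Tendsto (fun r => u (h r) / r) atTop (nhds 0) := by
  have key : Tendsto (fun r => C * (u (C * r) / (C * r))) atTop (nhds 0) := by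
    simpa using (hu.comp (tendsto_id.const_mul_atTop hC)).const_mul C
  refine squeeze_zero' ?_ ?_ key
  · filter_upwards [hh, eventually_gt_atTop 0] with r hr hr0
    exact div_nonneg (hu_nonneg _ hr.1) hr0.le
  · filter_upwards [hh, eventually_gt_atTop 0] with r hr hr0
    have : C * (u (C * r) / (C * r)) = u (C * r) / r := by field_simp
    rw [this]
    gcongr
    exact hu_mono _ _ hr.1 hr.2

theorem eventually_le_self_of_tendsto_div_zero {w : ℝ → ℝ}
    (hw : Tendsto (fun r => w r / r) atTop (nhds 0)) : ∀ᶠ r in atTop, w r ≤ r := by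
  filter_upwards [hw.eventually_lt_const one_pos, eventually_gt_atTop 0] with r hr hr0
  exact ((div_lt_one hr0).1 hr).le

/-- The maps `f_{l₁} ∘ f_{l₂}` and `f_{l₁ l₂}` (where `f_l = f ∘ L_l ∘ g`) are
sublinearly close: under upper `(L, u)`-SBE bounds on `f : Λ → X` and `g : X → Λ` with `u`
nondecreasing, subadditive and sublinear, `g x₀ = 1`, and `d(g (f a), a) ≤ u |a|`, for all
`l₁ l₂` there is a nondecreasing sublinear `v` with
`d(f (l₁·g (f (l₂·g x))), f ((l₁ l₂)·g x)) ≤ v |x|` for all `x`. -/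
theorem stmt_9 {Λ : Type*} [Group Λ] [MetricSpace Λ]
    (hleft : ∀ l a b : Λ, dist (l * a) (l * b) = dist a b)
    {X : Type*} [MetricSpace X] (x₀ : X)
    (L : ℝ) (hL : 1 ≤ L)
    (u : ℝ → ℝ) (hu_nonneg : ∀ r, 0 ≤ r → 0 ≤ u r)
    (hu_mono : ∀ r s, 0 ≤ r → r ≤ s → u r ≤ u s)
    (hu_subadd : ∀ t s : ℝ, 0 ≤ t → 0 ≤ s → u (t + s) ≤ u t + u s)
    (hu_sublinear : Filter.Tendsto (fun r => u r / r) Filter.atTop (nhds 0))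
    (f : Λ → X) (g : X → Λ)
    (hg0 : g x₀ = 1)
    (hf : ∀ a b : Λ, dist (f a) (f b) ≤ L * dist a b + u (max (dist a 1) (dist b 1)))
    (hg : ∀ x y : X, dist (g x) (g y) ≤ L * dist x y + u (max (dist x x₀) (dist y x₀)))
    (hgf : ∀ a : Λ, dist (g (f a)) a ≤ u (dist a 1)) :
    ∀ l₁ l₂ : Λ, ∃ v : ℝ → ℝ,
      (∀ r, 0 ≤ r → 0 ≤ v r) ∧ (∀ r s, 0 ≤ r → r ≤ s → v r ≤ v s) ∧
      Filter.Tendsto (fun r => v r / r) Filter.atTop (nhds 0) ∧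
      ∀ x : X, dist (f (l₁ * g (f (l₂ * g x)))) (f ((l₁ * l₂) * g x)) ≤ v (dist x x₀) := by
  intro l₁ l₂
  have hL0 : 0 ≤ L := zero_le_one.trans hL
  set W : ℝ → ℝ := fun r => L * r + u r + dist l₂ 1 with hW
  set V : ℝ → ℝ := fun r => u (W r) + W r + dist l₁ 1 with hV
  have hW0 : ∀ r, 0 ≤ r → 0 ≤ W r := fun r hr => by
    have := hu_nonneg r hr
    positivity
  have hWm : ∀ r s, 0 ≤ r → r ≤ s → W r ≤ W s := fun r s hr hrs => by
    have := hu_mono r s hr hrs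
    simp only [hW]
    gcongr
  have hV0 : ∀ r, 0 ≤ r → 0 ≤ V r := fun r hr => by
    have := hW0 r hr
    have := hu_nonneg _ this
    positivity
  have hVm : ∀ r s, 0 ≤ r → r ≤ s → V r ≤ V s := fun r s hr hrs => by
    have h1 := hWm r s hr hrs
    have h2 := hu_mono _ _ (hW0 r hr) h1
    simp only [hV]
    gcongr
  have huW : Tendsto (fun r => u (W r) / r) atTop (nhds 0) := by
    refine tendsto_comp_div_atTop_zero hu_nonneg hu_mono hu_sublinear
      (C := L + 2) (by positivity) ?_
    filter_upwards [eventually_le_self_of_tendsto_div_zero hu_sublinear, eventually_ge_atTop 0,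
      eventually_ge_atTop (dist l₂ 1)] with r h1 h2 h3
    exact ⟨hW0 r h2, by simp only [hW]; linarith⟩
  have huV : Tendsto (fun r => u (V r) / r) atTop (nhds 0) := by
    refine tendsto_comp_div_atTop_zero hu_nonneg hu_mono hu_sublinear
      (C := L + 4) (by positivity) ?_
    filter_upwards [eventually_le_self_of_tendsto_div_zero hu_sublinear,
      eventually_le_self_of_tendsto_div_zero huW, eventually_ge_atTop 0,
      eventually_ge_atTop (dist l₂ 1), eventually_ge_atTop (dist l₁ 1)] with r h1 h2 h3 h4 h5
    refine ⟨hV0 r h3, ?_⟩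
    have : W r = L * r + u r + dist l₂ 1 := rfl
    simp only [hV]
    linarith
  refine ⟨fun r => L * u (W r) + u (V r), fun r hr => ?_, fun r s hr hrs => ?_, ?_, fun x => ?_⟩
  · have h1 := hu_nonneg _ (hW0 r hr)
    have h2 := hu_nonneg _ (hV0 r hr)
    positivity
  · have h1 := hu_mono _ _ (hW0 r hr) (hWm r s hr hrs)
    have h2 := hu_mono _ _ (hV0 r hr) (hVm r s hr hrs)
    dsimp only
    gcongr
  · simpa [add_div, mul_div_assoc] using (huW.const_mul L).add huV
  · have dist_mul_one_le : ∀ l a : Λ, dist (l * a) 1 ≤ dist a 1 + dist l 1 := fun l a => by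
      have h1 := dist_triangle (l * a) (l * 1) 1
      rwa [hleft, mul_one] at h1
    have hgx : dist (g x) 1 ≤ L * dist x x₀ + u (dist x x₀) := by
      simpa [hg0] using hg x x₀
    rw [mul_assoc]
    set w := l₂ * g x
    have hw : dist w 1 ≤ W (dist x x₀) := (dist_mul_one_le l₂ (g x)).trans (by
      simp only [hW]; linarith)
    have hgfw : dist (g (f w)) w ≤ u (W (dist x x₀)) :=
      (hgf w).trans (hu_mono _ _ dist_nonneg hw)
    have huW0 : 0 ≤ u (W (dist x x₀)) := hu_nonneg _ (hW0 _ dist_nonneg)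
    have hmax : max (dist (l₁ * g (f w)) 1) (dist (l₁ * w) 1) ≤ V (dist x x₀) := by
      have h1 := dist_mul_one_le l₁ (g (f w))
      have h2 := dist_mul_one_le l₁ w
      have h3 := dist_triangle (g (f w)) w 1
      apply max_le <;> simp only [hV] <;> linarith
    have hmain := hf (l₁ * g (f w)) (l₁ * w)
    rw [hleft] at hmain
    refine hmain.trans (add_le_add (mul_le_mul_of_nonneg_left hgfw hL0) ?_)
    exact hu_mono _ _ (le_max_of_le_left dist_nonneg) hmax
end
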